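/- Assume ∫_X 1/(φ(x) − φ_o) ᾱ(dx) < 1/c (with the integrand +∞ where φ = φ_o) and that x_o is the unique minimizer of φ, with φ(x_o) = φ_o. Let f(x) := c/(φ(x) − φ_o), β := ∫_X f dᾱ (so β < 1), and let q* be the probability measure q*(A) := ∫_A f dᾱ + (1−β)·δ_{x_o}(A). Then for every q ∈ 𝒫_1 with q ≠ q* it holds that −∫_X φ dq − c·D(ᾱ‖q) < −∫_X φ dq* − c·D(ᾱ‖q*), the right-hand side being equal to −(φ_o + c) + c ∫_X ln f dᾱ. -/

import Mathlib

open MeasureTheory Filter Topology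
open scoped ENNReal Classical

/-- The (possibly `−∞`-valued) integral `∫ log g dμ`, as an extended real number:
the positive part minus the negative part (each computed as a lower integral). -/
noncomputable def intLog {X : Type*} [MeasurableSpace X] (μ : Measure X) (g : X → ℝ) : EReal :=
  ((∫⁻ x, ENNReal.ofReal (Real.log (g x)) ∂μ : ℝ≥0∞) : EReal)
    - ((∫⁻ x, ENNReal.ofReal (-Real.log (g x)) ∂μ : ℝ≥0∞) : EReal)

/-- The relative entropy `D(p‖q) = ∫ ln(dp/dq) dp` if `p ≪ q`, and `+∞` otherwise,
as an extended real number. -/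
noncomputable def relEnt {X : Type*} [MeasurableSpace X] (p q : Measure X) : EReal :=
  if p ≪ q then intLog p (fun x => (p.rnDeriv q x).toReal) else ⊤


lemma aux_coe {a : ℝ≥0∞} (h : a ≠ ∞) : ((a.toReal : ℝ) : EReal) = (a : EReal) := by
  lift a to NNReal using h
  rfl

lemma aux_intLog {X : Type*} [MeasurableSpace X] (μ : Measure X) (g : X → ℝ)
    (hg : Integrable (fun x => Real.log (g x)) μ) :
    intLog μ g = ((∫ x, Real.log (g x) ∂μ : ℝ) : EReal) := by
  have h1 : (∫⁻ x, ENNReal.ofReal (Real.log (g x)) ∂μ) ≠ ∞ := hg.lintegral_lt_top.ne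
  have h2 : (∫⁻ x, ENNReal.ofReal (-Real.log (g x)) ∂μ) ≠ ∞ := hg.neg.lintegral_lt_top.ne
  rw [integral_eq_lintegral_pos_part_sub_lintegral_neg_part hg, EReal.coe_sub,
    aux_coe h1, aux_coe h2]
  rfl

lemma aux_intLog_congr {X : Type*} [MeasurableSpace X] (μ : Measure X) (g k : X → ℝ)
    (h : g =ᵐ[μ] k) : intLog μ g = intLog μ k := by
  unfold intLog
  rw [lintegral_congr_ae (g := fun x => ENNReal.ofReal (Real.log (k x)))
      (h.mono fun x hx => by simp only [hx]),
    lintegral_congr_ae (f := fun x => ENNReal.ofReal (-Real.log (g x)))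
      (g := fun x => ENNReal.ofReal (-Real.log (k x)))
      (h.mono fun x hx => by simp only [hx])]

lemma aux_relEnt {X : Type*} [MeasurableSpace X] (α q : Measure X) [IsFiniteMeasure α]
    [IsFiniteMeasure q] (h : α ≪ q) :
    relEnt α q = intLog α (fun x => ((q.rnDeriv α x).toReal)⁻¹) := by
  rw [relEnt, if_pos h]
  apply aux_intLog_congr
  filter_upwards [Measure.inv_rnDeriv h] with x hx
  rw [← hx]
  simp [ENNReal.toReal_inv]

lemma aux_top {X : Type*} [MeasurableSpace X] (α : Measure X) (h : X → ℝ)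
    (hm : Measurable h) (hnn : ∀ x, 0 ≤ h x)
    (hi : Integrable h α) (hni : ¬ Integrable (fun x => Real.log (h x)) α) :
    intLog α (fun x => (h x)⁻¹) = ⊤ := by
  unfold intLog
  simp only [Real.log_inv, neg_neg]
  have h2 : (∫⁻ x, ENNReal.ofReal (Real.log (h x)) ∂α) < ∞ := by
    refine lt_of_le_of_lt (lintegral_mono fun x => ?_) hi.lintegral_lt_top
    exact ENNReal.ofReal_le_ofReal (Real.log_le_self (hnn x))
  have h1 : (∫⁻ x, ENNReal.ofReal (-Real.log (h x)) ∂α) = ∞ := by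
    by_contra hne
    apply hni
    refine ⟨hm.log.aestronglyMeasurable, ?_⟩
    rw [hasFiniteIntegral_iff_norm]
    calc ∫⁻ x, ENNReal.ofReal ‖Real.log (h x)‖ ∂α
        ≤ ∫⁻ x, (ENNReal.ofReal (Real.log (h x)) + ENNReal.ofReal (-Real.log (h x))) ∂α := by
          apply lintegral_mono
          intro x
          rcases le_total 0 (Real.log (h x)) with h0 | h0
          · simp [Real.norm_eq_abs, abs_of_nonneg h0]
          · simp [Real.norm_eq_abs, abs_of_nonpos h0]
      _ < ∞ := by
          rw [lintegral_add_left hm.log.ennreal_ofReal]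
          exact ENNReal.add_lt_top.2 ⟨h2, lt_top_iff_ne_top.2 hne⟩
  rw [h1, ← aux_coe h2.ne, EReal.coe_ennreal_top, EReal.top_sub_coe]

lemma aux_split {X : Type*} [MeasurableSpace X] (α q : Measure X) [IsFiniteMeasure α]
    [IsFiniteMeasure q] (ψ : X → ℝ) (hψ : Measurable ψ) (M : ℝ) (hM : ∀ x, ‖ψ x‖ ≤ M) :
    Integrable (fun x => (q.rnDeriv α x).toReal * ψ x) α ∧
    ∫ x, ψ x ∂q = ∫ x, ψ x ∂(q.singularPart α) + ∫ x, (q.rnDeriv α x).toReal * ψ x ∂α := by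
  have hI : ∀ (μ : Measure X) [IsFiniteMeasure μ], Integrable ψ μ := fun μ _ =>
    Integrable.of_bound hψ.aestronglyMeasurable M (ae_of_all _ hM)
  refine ⟨(Measure.integrable_toReal_rnDeriv (μ := q) (ν := α)).mul_bdd (c := M)
    hψ.aestronglyMeasurable (ae_of_all _ hM), ?_⟩
  conv_lhs => rw [q.haveLebesgueDecomposition_add α]
  rw [integral_add_measure (hI _) (hI _),
    integral_withDensity_eq_integral_toReal_smul (Measure.measurable_rnDeriv _ _)
      (Measure.rnDeriv_lt_top q α)]
  simp

/-- **Lemma `lemma2a` (inequality \eqref{marta2} fails).**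
Under `∫ 1/(φ − φ₀) dᾱ < 1/c`, `x₀` the unique minimizer of `φ` (`φ(x₀) = φ₀`),
`f = c/(φ − φ₀)`, `β = ∫ f dᾱ < 1` and `q* = f dᾱ + (1−β) δ_{x₀}`: every Borel
probability measure `q` with `ᾱ ≪ q` and `q ≠ q*` satisfies
`−∫ φ dq − c·D(ᾱ‖q) < −∫ φ dq* − c·D(ᾱ‖q*)`, and the right-hand side equals
`−(φ₀ + c) + c ∫ ln f dᾱ`. -/
theorem stmt_19
    {X : Type*} [MeasurableSpace X] [TopologicalSpace X] [PolishSpace X] [BorelSpace X]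
    (α : Measure X) [IsProbabilityMeasure α]
    (φ : X → ℝ) (hφ0 : ∀ x, 0 ≤ φ x) (hφcont : Continuous φ) (hφbdd : ∃ M : ℝ, ∀ x, φ x ≤ M)
    (xo : X) (φo : ℝ) (hφo : φo = φ xo)
    (hxo_min : ∀ x, φ xo ≤ φ x) (hxo_unique : ∀ x, x ≠ xo → φ xo < φ x)
    (c : ℝ) (hc : 0 < c)
    (hmarta2_fails : (∫⁻ x, 1 / ENNReal.ofReal (φ x - φo) ∂α) < ENNReal.ofReal (1 / c))
    (f : X → ℝ) (hf : f = fun x => c / (φ x - φo))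
    (β : ℝ) (hβ : β = ∫ x, f x ∂α) (hβlt : β < 1)
    (qstar : Measure X)
    (hqstar : qstar = α.withDensity (fun x => ENNReal.ofReal (f x))
      + (ENNReal.ofReal (1 - β)) • Measure.dirac xo)
    (q : Measure X) [IsProbabilityMeasure q]
    (hα_ac_q : α ≪ q) (hq_ne : q ≠ qstar) :
    (((-∫ x, φ x ∂q : ℝ)) : EReal) - (c : EReal) * relEnt α q
      < (((-∫ x, φ x ∂qstar : ℝ)) : EReal) - (c : EReal) * relEnt α qstar
    ∧ (((-∫ x, φ x ∂qstar : ℝ)) : EReal) - (c : EReal) * relEnt α qstar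
      = (((-(φo + c) + c * ∫ x, Real.log (f x) ∂α : ℝ)) : EReal) := by
  obtain ⟨M, hM⟩ := hφbdd
  have hφm : Measurable φ := hφcont.measurable
  have hψm : Measurable (fun x => φ x - φo) := hφm.sub_const _
  have hψ0 : ∀ x, 0 ≤ φ x - φo := fun x => by rw [hφo]; linarith [hxo_min x]
  have hψM : ∀ x, ‖φ x - φo‖ ≤ M := fun x => by
    rw [Real.norm_eq_abs, abs_of_nonneg (hψ0 x)]
    have := hφ0 xo; rw [← hφo] at this; linarith [hM x]
  have hfm : Measurable f := by rw [hf]; exact hψm.const_div c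
  have hf0 : ∀ x, 0 ≤ f x := fun x => by rw [hf]; exact div_nonneg hc.le (hψ0 x)
  have hlt : (∫⁻ x, 1 / ENNReal.ofReal (φ x - φo) ∂α) < ∞ :=
    hmarta2_fails.trans ENNReal.ofReal_lt_top
  have hm1 : Measurable (fun x => 1 / ENNReal.ofReal (φ x - φo)) :=
    hψm.ennreal_ofReal.const_div 1
  have hpos : ∀ᵐ x ∂α, 0 < φ x - φo := by
    filter_upwards [ae_lt_top hm1 hlt.ne] with x hx
    by_contra hcon
    rw [ENNReal.ofReal_of_nonpos (not_lt.1 hcon)] at hx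
    simp at hx
  have hfpos : ∀ᵐ x ∂α, 0 < f x := by
    filter_upwards [hpos] with x hx
    rw [hf]; exact div_pos hc hx
  have hαxo : α {xo} = 0 := by
    have : {xo} ⊆ {x | ¬ 0 < φ x - φo} := by
      rintro x rfl; simp [hφo]
    exact measure_mono_null this hpos
  have hfi : Integrable f α := by
    refine ⟨hfm.aestronglyMeasurable, ?_⟩
    rw [hasFiniteIntegral_iff_ofReal (ae_of_all _ hf0)]
    have : ∫⁻ x, ENNReal.ofReal (f x) ∂α
        = ∫⁻ x, ENNReal.ofReal c * (1 / ENNReal.ofReal (φ x - φo)) ∂α := by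
      apply lintegral_congr_ae
      filter_upwards [hpos] with x hx
      simp only [hf]
      rw [ENNReal.ofReal_div_of_pos hx, one_div, div_eq_mul_inv]
    rw [this, lintegral_const_mul _ hm1]
    exact ENNReal.mul_lt_top ENNReal.ofReal_lt_top hlt
  have hβ0 : 0 ≤ β := by rw [hβ]; exact integral_nonneg hf0
  have hlf : ∫⁻ x, ENNReal.ofReal (f x) ∂α = ENNReal.ofReal β := by
    rw [hβ, ofReal_integral_eq_lintegral_ofReal hfi (ae_of_all _ hf0)]
  have hlogf : Integrable (fun x => Real.log (f x)) α := by
    refine Integrable.mono' (g := fun x => f x + |Real.log (c / M)|) (hfi.add (integrable_const _))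
      hfm.log.aestronglyMeasurable ?_
    filter_upwards [hpos, hfpos] with x hx hx2
    have hxM : φ x - φo ≤ M := le_trans (le_abs_self _) (hψM x)
    have hMpos : 0 < M := hx.trans_le hxM
    have h1 : Real.log (c / M) ≤ Real.log (f x) := by
      apply Real.log_le_log (div_pos hc hMpos)
      rw [hf]; exact div_le_div_of_nonneg_left hc.le hx hxM
    have h2 := Real.log_le_self (hf0 x)
    rw [Real.norm_eq_abs, abs_le]
    have h3 := neg_abs_le (Real.log (c / M))
    have h4 := abs_nonneg (Real.log (c / M))
    have h5 := hf0 x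
    constructor <;> linarith
  have hfinq : IsProbabilityMeasure qstar := by
    constructor
    rw [hqstar]
    simp only [Measure.coe_add, Pi.add_apply, Measure.smul_apply, smul_eq_mul,
      withDensity_apply _ MeasurableSet.univ, Measure.restrict_univ, hlf, measure_univ, mul_one]
    rw [← ENNReal.ofReal_add hβ0 (by linarith)]
    simp
  have hsing : (ENNReal.ofReal (1 - β)) • Measure.dirac xo ⟂ₘ α := by
    refine ⟨{xo}ᶜ, (measurableSet_singleton _).compl, ?_, ?_⟩
    · simp [Measure.dirac_apply' _ (measurableSet_singleton xo).compl]
    · simpa using hαxo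
  have hrn : (fun x => ENNReal.ofReal (f x)) =ᵐ[α] qstar.rnDeriv α :=
    Measure.eq_rnDeriv hfm.ennreal_ofReal hsing (by rw [hqstar, add_comm])
  have hacs : α ≪ qstar := by
    have h1 : α ≪ α.withDensity (fun x => ENNReal.ofReal (f x)) := by
      apply withDensity_absolutelyContinuous' hfm.ennreal_ofReal.aemeasurable
      filter_upwards [hfpos] with x hx
      simpa using hx
    rw [hqstar]
    exact h1.trans (Measure.le_add_right le_rfl).absolutelyContinuous
  have hrs : relEnt α qstar = ((-∫ x, Real.log (f x) ∂α : ℝ) : EReal) := by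
    rw [aux_relEnt α qstar hacs, aux_intLog_congr α _ (fun x => (f x)⁻¹), aux_intLog]
    · simp only [Real.log_inv, integral_neg]
    · simp only [Real.log_inv]; exact hlogf.neg
    · filter_upwards [hrn] with x hx
      rw [← hx, ENNReal.toReal_ofReal (hf0 x)]
  have hfψ : ∀ᵐ x ∂α, f x * (φ x - φo) = c := by
    filter_upwards [hpos] with x hx
    rw [hf]; exact div_mul_cancel₀ _ hx.ne'
  have hφI : ∀ (μ : Measure X) [IsFiniteMeasure μ], Integrable φ μ := fun μ _ =>
    Integrable.of_bound hφm.aestronglyMeasurable M (ae_of_all _ fun x => by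
      rw [Real.norm_eq_abs, abs_of_nonneg (hφ0 x)]; exact hM x)
  have hsub : ∀ (μ : Measure X) [IsProbabilityMeasure μ],
      ∫ x, (φ x - φo) ∂μ = ∫ x, φ x ∂μ - φo := fun μ _ => by
    rw [integral_sub (hφI μ) (integrable_const _)]; simp
  have hsp : qstar.singularPart α = (ENNReal.ofReal (1 - β)) • Measure.dirac xo :=
    (Measure.eq_singularPart hfm.ennreal_ofReal hsing (by rw [hqstar, add_comm])).symm
  have hφs : ∫ x, φ x ∂qstar = φo + c := by
    have h := (aux_split α qstar _ hψm M hψM).2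
    rw [hsub qstar, hsp] at h
    have h1 : ∫ x, (qstar.rnDeriv α x).toReal * (φ x - φo) ∂α = c := by
      rw [integral_congr_ae (g := fun _ => c)]
      · simp
      · filter_upwards [hrn, hfψ] with x hx hx2
        rw [← hx, ENNReal.toReal_ofReal (hf0 x), hx2]
    rw [h1, integral_smul_measure, integral_dirac] at h
    rw [← hφo] at h
    simp at h
    linarith
  have hR : (((-∫ x, φ x ∂qstar : ℝ)) : EReal) - (c : EReal) * relEnt α qstar
      = (((-(φo + c) + c * ∫ x, Real.log (f x) ∂α : ℝ)) : EReal) := by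
    rw [hrs, hφs, ← EReal.coe_mul, ← EReal.coe_sub]
    congr 1
    ring
  refine ⟨?_, hR⟩
  rw [hR, aux_relEnt α q hα_ac_q]
  have hhm : Measurable (fun x => (q.rnDeriv α x).toReal) :=
    (Measure.measurable_rnDeriv q α).ennreal_toReal
  by_cases hlogh : Integrable (fun x => Real.log ((q.rnDeriv α x).toReal)) α
  swap
  · rw [aux_top α (fun x => (q.rnDeriv α x).toReal) hhm (fun x => ENNReal.toReal_nonneg)
      Measure.integrable_toReal_rnDeriv hlogh, EReal.coe_mul_top_of_pos hc, EReal.sub_top]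
    exact EReal.bot_lt_coe _
  rw [aux_intLog _ _ (by simp only [Real.log_inv]; exact hlogh.neg), ← EReal.coe_mul,
    ← EReal.coe_sub, EReal.coe_lt_coe_iff]
  simp only [Real.log_inv, integral_neg]
  by_contra hcon
  apply hq_ne
  obtain ⟨hi, hsplit⟩ := aux_split α q _ hψm M hψM
  rw [hsub q] at hsplit
  set h : X → ℝ := fun x => (q.rnDeriv α x).toReal with hh
  have hhpos : ∀ᵐ x ∂α, 0 < h x := by
    filter_upwards [Measure.rnDeriv_pos' hα_ac_q, Measure.rnDeriv_lt_top q α] with x h1 h2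
    exact ENNReal.toReal_pos h1.ne' h2.ne
  let w : X → ℝ := fun x => h x * (φ x - φo) - c - c * (Real.log (h x) - Real.log (f x))
  have key : ∀ᵐ x ∂α, w x = c * (h x / f x - 1 - Real.log (h x / f x)) := by
    filter_upwards [hpos, hfpos, hhpos] with x h1 h2 h3
    simp only [w]
    rw [Real.log_div h3.ne' h2.ne']
    have : c * (h x / f x) = h x * (φ x - φo) := by
      rw [hf]; field_simp
    linear_combination -this
  have hw0 : 0 ≤ᵐ[α] w := by
    filter_upwards [key, hfpos, hhpos] with x h1 h2 h3
    rw [h1]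
    have := Real.log_le_sub_one_of_pos (div_pos h3 h2)
    exact mul_nonneg hc.le (by linarith)
  have hwi : Integrable w α := (hi.sub (integrable_const c)).sub ((hlogh.sub hlogf).const_mul c)
  have hwint : ∫ x, w x ∂α = ∫ x, h x * (φ x - φo) ∂α - c
      - c * (∫ x, Real.log (h x) ∂α - ∫ x, Real.log (f x) ∂α) := by
    have e1 : Integrable (fun x => h x * (φ x - φo) - c) α := hi.sub (integrable_const c)
    have e2 : Integrable (fun x => Real.log (h x) - Real.log (f x)) α := hlogh.sub hlogf
    have e3 : Integrable (fun x => h x * (φ x - φo)) α := hi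
    have e4 : Integrable (fun x => Real.log (h x)) α := hlogh
    simp only [w]
    rw [integral_sub e1 (e2.const_mul c),
      integral_sub e3 (integrable_const c), integral_const_mul, integral_sub e4 hlogf]
    simp
  have hs0 : 0 ≤ ∫ x, (φ x - φo) ∂(q.singularPart α) := integral_nonneg hψ0
  have hw0' : 0 ≤ ∫ x, w x ∂α := integral_nonneg_of_ae hw0
  have hsum : ∫ x, (φ x - φo) ∂(q.singularPart α) + ∫ x, w x ∂α ≤ 0 := by
    rw [hwint]
    have : ∫ x, (fun x => h x * (φ x - φo)) x ∂α = ∫ x, h x * (φ x - φo) ∂α := rfl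
    simp only [hh] at *
    nlinarith
  have hwz : ∫ x, w x ∂α = 0 := by linarith
  have hsz : ∫ x, (φ x - φo) ∂(q.singularPart α) = 0 := by linarith
  rw [integral_eq_zero_iff_of_nonneg_ae hw0 hwi] at hwz
  rw [integral_eq_zero_iff_of_nonneg hψ0
    (Integrable.of_bound hψm.aestronglyMeasurable M (ae_of_all _ hψM))] at hsz
  have hhf : q.rnDeriv α =ᵐ[α] fun x => ENNReal.ofReal (f x) := by
    filter_upwards [key, hfpos, hhpos, hwz, Measure.rnDeriv_lt_top q α] with x h1 h2 h3 h4 h5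
    have h6 : h x / f x = 1 := by
      by_contra hne
      have := Real.log_lt_sub_one_of_pos (div_pos h3 h2) hne
      rw [h1] at h4
      have h7 : 0 < c * (h x / f x - 1 - Real.log (h x / f x)) := mul_pos hc (by linarith)
      exact h7.ne' h4
    rw [div_eq_one_iff_eq h2.ne'] at h6
    rw [← h6, hh]
    exact (ENNReal.ofReal_toReal h5.ne).symm
  have hsx : ∀ᵐ x ∂(q.singularPart α), x = xo := by
    filter_upwards [hsz] with x hx
    by_contra hne
    have := hxo_unique x hne
    rw [← hφo] at this
    simp only [Pi.zero_apply] at hx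
    linarith
  have hq : q = q.singularPart α + α.withDensity (fun x => ENNReal.ofReal (f x)) := by
    conv_lhs => rw [q.haveLebesgueDecomposition_add α]
    rw [withDensity_congr_ae hhf]
  have hmass : q.singularPart α Set.univ = ENNReal.ofReal (1 - β) := by
    have h1 : q Set.univ = 1 := measure_univ
    rw [congrArg (fun μ : Measure X => μ Set.univ) hq, Measure.add_apply, withDensity_apply _ MeasurableSet.univ, Measure.restrict_univ,
      hlf] at h1
    rw [ENNReal.ofReal_sub _ hβ0, ENNReal.ofReal_one, ← h1]
    exact (ENNReal.add_sub_cancel_right ENNReal.ofReal_ne_top).symm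
  have hsd : q.singularPart α = (ENNReal.ofReal (1 - β)) • Measure.dirac xo := by
    ext s hs
    rw [Measure.smul_apply, Measure.dirac_apply' _ hs, ← hmass, smul_eq_mul]
    by_cases hx : xo ∈ s
    · rw [Set.indicator_of_mem hx, Pi.one_apply, mul_one]
      apply measure_congr
      filter_upwards [hsx] with x hx'
      subst hx'
      exact propext ⟨fun _ => trivial, fun _ => hx⟩
    · rw [Set.indicator_of_notMem hx, mul_zero]
      refine measure_mono_null (fun x hxs => ?_) hsx
      intro hx'
      exact hx (hx' ▸ hxs)
  rw [hqstar, add_comm, ← hsd]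
  exact hq
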